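/- Let ℂ² have basis e_{-1}, e_1, P° = Σ_{i,j∈{-1,1}} E_{ij}⊗E_{ji}, R°(u) = I − P°/u, and let K'°(u) be the diagonal operator on ℂ²⊗ℂ² acting as 1, (1+4u)/(1−4u), (1+4u)/(1−4u), 1 on the ordered basis e_{-1}⊗e_{-1}, e_{-1}⊗e_1, e_1⊗e_{-1}, e_1⊗e_1. Let ι: ℂ³ → ℂ²⊗ℂ² send the standard basis w_{-1}, w_0, w_1 of ℂ³ to v_{-1} = e_{-1}⊗e_{-1}, v_0 = (1/√2)(e_{-1}⊗e_1 + e_1⊗e_{-1}), v_1 = −e_1⊗e_1, and let K'(u) be the diagonal operator on ℂ³ acting as 1, (1+4u)/(1−4u), 1 on w_{-1}, w_0, w_1. Then, as an identity of rational functions in u, ½R°(−1)·K'°(u)·ι = ι·K'(u), i.e. the restriction of ½R°(−1)K'°(u) to the symmetric subspace V = Im ι equals the type BDI K-matrix K'(u) of the pair (so₃, so₂). -/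

import Mathlib

open Matrix Kronecker Finset

noncomputable section

/-- The index set `I_N` as a subtype of `ℤ` determined by a finite set `S ⊆ ℤ`. -/
abbrev Idx (S : Finset ℤ) : Type := {i : ℤ // i ∈ S}

/-- The matrix unit `E_{ab}` of `End(ℂ^N)` (zero if `a` or `b` is not in the index set). -/
def Emat (S : Finset ℤ) (a b : ℤ) : Matrix (Idx S) (Idx S) ℂ :=
  fun p q => if ((p : ℤ) = a ∧ (q : ℤ) = b) then 1 else 0

/-- The permutation operator `P = Σ_{i,j} E_{ij} ⊗ E_{ji}` on `ℂ^N ⊗ ℂ^N`. -/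
def Pmat (S : Finset ℤ) : Matrix (Idx S × Idx S) (Idx S × Idx S) ℂ :=
  ∑ i ∈ S, ∑ j ∈ S, Emat S i j ⊗ₖ Emat S j i

/-- The operator `Q = Σ_{i,j} θ_{ij} E_{ij} ⊗ E_{-i,-j}` on `ℂ^N ⊗ ℂ^N`. -/
def Qmat (S : Finset ℤ) (θ : ℤ → ℤ → ℂ) : Matrix (Idx S × Idx S) (Idx S × Idx S) ℂ :=
  ∑ i ∈ S, ∑ j ∈ S, θ i j • (Emat S i j ⊗ₖ Emat S (-i) (-j))

/-- The R-matrix `R(u) = I - P/u + Q/(u - κ)` of types B, C, D. -/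
def Rmat (S : Finset ℤ) (θ : ℤ → ℤ → ℂ) (κ u : ℂ) :
    Matrix (Idx S × Idx S) (Idx S × Idx S) ℂ :=
  1 - u⁻¹ • Pmat S + (u - κ)⁻¹ • Qmat S θ

/-- `θ_{ij} = 1` (orthogonal case). -/
def θorth : ℤ → ℤ → ℂ := fun _ _ => 1

/-- `θ_{ij} = sign(i)·sign(j)` (symplectic case). -/
def θsymp : ℤ → ℤ → ℂ := fun i j =>
  (if 0 < i then (1 : ℂ) else -1) * (if 0 < j then (1 : ℂ) else -1)

/-- The two-element index set `{-1, 1}` for `ℂ²`. -/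
def S2 : Finset ℤ := {-1, 1}

abbrev V2 : Type := Idx S2

/-- Negation `i ↦ -i` on the index set `{-1, 1}`. -/
def nneg (p : V2) : V2 :=
  ⟨-(p : ℤ), by
    have h := p.2
    simp only [S2, Finset.mem_insert, Finset.mem_singleton] at h ⊢
    omega⟩

/-- The rational R-matrix `R°(u) = I - P°/u` of type A on `ℂ² ⊗ ℂ²`. -/
def Ro (u : ℂ) : Matrix (V2 × V2) (V2 × V2) ℂ := 1 - u⁻¹ • Pmat S2

/-- `sign(i)` for `i ∈ {-1, 1}`. -/
def ssgn : V2 → ℂ := fun i => if 0 < (i : ℤ) then 1 else -1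

/-- Partial transpose applied to the first tensor factor of `ℂ² ⊗ ℂ²`, for the transpose
`M ↦ Σ_{i,j} s(i) s(j) M_{ij} E_{-j,-i}` of `2 × 2` matrices (take `s ≡ 1` for `t₊` and
`s = sign` for `t₋`). -/
def pt1 (s : V2 → ℂ) (X : Matrix (V2 × V2) (V2 × V2) ℂ) :
    Matrix (V2 × V2) (V2 × V2) ℂ :=
  fun p q => s p.1 * s q.1 * X (nneg q.1, p.2) (nneg p.1, q.2)

/-- The three-element index set `{-1, 0, 1}` for `ℂ³`. -/
def S3 : Finset ℤ := {-1, 0, 1}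

abbrev V3 : Type := Idx S3

/-- The embedding `ι : ℂ³ → ℂ² ⊗ ℂ²` sending the standard basis `w₋₁, w₀, w₁` to
`v₋₁ = e₋₁⊗e₋₁`, `v₀ = (1/√2)(e₋₁⊗e₁ + e₁⊗e₋₁)`, `v₁ = -e₁⊗e₁`, as a matrix. -/
def iota : Matrix (V2 × V2) V3 ℂ := fun p w =>
  if (w : ℤ) = -1 then (if ((p.1 : ℤ) = -1 ∧ (p.2 : ℤ) = -1) then 1 else 0)
  else if (w : ℤ) = 0 then
    (if (((p.1 : ℤ) = -1 ∧ (p.2 : ℤ) = 1) ∨ ((p.1 : ℤ) = 1 ∧ (p.2 : ℤ) = -1)) then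
      ((Real.sqrt 2 : ℂ))⁻¹ else 0)
  else (if ((p.1 : ℤ) = 1 ∧ (p.2 : ℤ) = 1) then -1 else 0)

/-- The projector `½R°(-1) = ½(I + P°)`. -/
def halfR : Matrix (V2 × V2) (V2 × V2) ℂ := (2 : ℂ)⁻¹ • Ro (-1)

/-- The diagonal operator `K'°(u)` acting as `1, (1+4u)/(1-4u), (1+4u)/(1-4u), 1` on the
ordered basis `e₋₁⊗e₋₁, e₋₁⊗e₁, e₁⊗e₋₁, e₁⊗e₁` of `ℂ² ⊗ ℂ²`. -/
def Kco (u : ℂ) : Matrix (V2 × V2) (V2 × V2) ℂ :=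
  Matrix.diagonal (fun p => if p.1 = p.2 then 1 else (1 + 4 * u) / (1 - 4 * u))

/-- The type BDI K-matrix `K'(u)` of the pair `(so₃, so₂)`: the diagonal operator acting as
`1, (1+4u)/(1-4u), 1` on the basis `w₋₁, w₀, w₁` of `ℂ³`. -/
def Kp3 (u : ℂ) : Matrix V3 V3 ℂ :=
  Matrix.diagonal (fun w => if (w : ℤ) = 0 then (1 + 4 * u) / (1 - 4 * u) else 1)

theorem Pmat_apply (S : Finset ℤ) (p q : Idx S × Idx S) :
    Pmat S p q = if p.swap = q then 1 else 0 := by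
  obtain ⟨⟨a, ha⟩, b, hb⟩ := p
  obtain ⟨⟨c, hc⟩, d, hd⟩ := q
  simp only [Pmat, Matrix.sum_apply, Matrix.kroneckerMap_apply, Emat]
  rw [Finset.sum_eq_single_of_mem a ha (fun i _ hi => Finset.sum_eq_zero fun j _ => by
    simp [hi.symm]), Finset.sum_eq_single_of_mem b hb (fun j _ hj => by simp [hj.symm])]
  simp [← ite_and, and_comm, eq_comm]

theorem Pmat_mul_apply {n : Type*} (S : Finset ℤ) (M : Matrix (Idx S × Idx S) n ℂ)
    (p : Idx S × Idx S) (w : n) : (Pmat S * M) p w = M p.swap w := by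
  simp [Matrix.mul_apply, Pmat_apply]

theorem Pmat_mul_iota : Pmat S2 * iota = iota := by
  ext p w
  simp only [Pmat_mul_apply, iota, Prod.fst_swap, Prod.snd_swap]
  congr 2
  · simp only [and_comm]
  · simp only [and_comm, or_comm]
  · simp only [and_comm]

theorem halfR_mul_iota : halfR * iota = iota := by
  rw [halfR, Ro, Matrix.smul_mul, Matrix.sub_mul, Matrix.smul_mul, Pmat_mul_iota, Matrix.one_mul]
  module

theorem Kco_mul_iota (u : ℂ) : Kco u * iota = iota * Kp3 u := by
  ext p w
  simp only [Kco, Kp3, Matrix.diagonal_mul, Matrix.mul_diagonal, iota, Subtype.ext_iff]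
  split_ifs <;> first | omega | ring

/-- `½R°(-1)·K'°(u)·ι = ι·K'(u)`, i.e. the restriction of `½R°(-1)K'°(u)` to
the symmetric subspace `V = Im ι` is the type BDI K-matrix of the pair `(so₃, so₂)`. -/
theorem K_restriction (u : ℂ) (h : 4 * u ≠ 1) :
    halfR * Kco u * iota = iota * Kp3 u := by
  rw [Matrix.mul_assoc, Kco_mul_iota, ← Matrix.mul_assoc, halfR_mul_iota]
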